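/- Let (f, g) be non-constant real polynomials with Sturm matrix S_{f,g}(x) and f̃₀ = f/gcd(f,g), f̃₁ = g/gcd(f,g). If c ∈ ℝ satisfies f̃₀(c) = 0, then there exists ε > 0 such that f and g are nonzero on (c−ε, c) ∪ (c, c+ε), and for x in this punctured neighborhood: q(S_{f,g}(x)) = q(S_{f,g}(c)) if f(x)g(x) > 0, and q(S_{f,g}(x)) = q(S_{f,g}(c)) + 1 if f(x)g(x) < 0. -/

import Mathlib

open Polynomial Matrix

/-- The negative index of inertia of a real symmetric matrix. -/
noncomputable def negInertia {n : ℕ} (M : Matrix (Fin n) (Fin n) ℝ) : ℕ :=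
  if h : M.IsHermitian then (Finset.univ.filter fun i => h.eigenvalues i < 0).card
  else 0

/-- The Sturm matrix: the `m × m` symmetric tridiagonal matrix with diagonal
entries `d 1 x, …, d m x` and off-diagonal entries `1`. -/
noncomputable def sturmMatrix (m : ℕ) (d : ℕ → Polynomial ℝ) (x : ℝ) :
    Matrix (Fin m) (Fin m) ℝ :=
  Matrix.of fun i j =>
    if (i : ℕ) = (j : ℕ) then (d ((i : ℕ) + 1)).eval x
    else if (i : ℕ) + 1 = (j : ℕ) ∨ (j : ℕ) + 1 = (i : ℕ) then 1 else 0

lemma Matrix.toQuadraticForm'_apply {n : ℕ} (M : Matrix (Fin n) (Fin n) ℝ) (v : Fin n → ℝ) :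
    M.toQuadraticForm' v = v ⬝ᵥ M *ᵥ v := by
  simp [Matrix.toQuadraticForm', Matrix.toLinearMap₂'_apply']

/-- The quadratic forms of congruent matrices are equivalent. -/
lemma Matrix.toQuadraticForm'_equivalent_congr {n : ℕ} (M : Matrix (Fin n) (Fin n) ℝ)
    {P : Matrix (Fin n) (Fin n) ℝ} (hP : IsUnit P) :
    (Pᵀ * M * P).toQuadraticForm'.Equivalent M.toQuadraticForm' := by
  have hdet : IsUnit P.det := (Matrix.isUnit_iff_isUnit_det P).1 hP
  refine ⟨⟨P.toLinearEquiv' (P.invertibleOfIsUnitDet hdet), fun v => ?_⟩⟩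
  simp [Matrix.toQuadraticForm', Matrix.toLinearMap₂'_apply', Matrix.toLinearEquiv',
    ← Matrix.mulVec_mulVec, Matrix.dotProduct_mulVec, Matrix.vecMul_transpose]

lemma negInertia_eq_sigNeg {n : ℕ} {M : Matrix (Fin n) (Fin n) ℝ} (hM : M.IsHermitian) :
    negInertia M = sigNeg M.toQuadraticForm' := by
  have hU : IsUnit (hM.eigenvectorUnitary : Matrix (Fin n) (Fin n) ℝ) :=
    (Unitary.toUnits hM.eigenvectorUnitary).isUnit
  have hdiag := hM.conjStarAlgAut_star_eigenvectorUnitary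
  rw [Unitary.conjStarAlgAut_apply] at hdiag
  have hequiv := (Matrix.toQuadraticForm'_equivalent_congr M hU).symm
  have hform : ((hM.eigenvectorUnitary : Matrix (Fin n) (Fin n) ℝ)ᵀ * M *
      (hM.eigenvectorUnitary : Matrix (Fin n) (Fin n) ℝ)).toQuadraticForm' =
        QuadraticMap.weightedSumSquares ℝ hM.eigenvalues := by
    have : ((hM.eigenvectorUnitary : Matrix (Fin n) (Fin n) ℝ)ᵀ * M *
      (hM.eigenvectorUnitary : Matrix (Fin n) (Fin n) ℝ)) = diagonal hM.eigenvalues := by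
      simpa [star_eq_conjTranspose] using hdiag
    rw [this]
    ext v
    simp only [Matrix.toQuadraticForm'_apply, dotProduct, mulVec_diagonal,
      QuadraticMap.weightedSumSquares_apply, smul_eq_mul]
    exact Finset.sum_congr rfl fun i _ => by ring
  rw [hform] at hequiv
  rw [QuadraticForm.sigNeg_of_equiv_weightedSumSquares hequiv, negInertia, dif_pos hM,
    Set.ncard_eq_toFinset_card']
  simp

/-- Positive definiteness on a fixed subspace is an open condition. -/
lemma eventually_posDef_restrict {n : ℕ} {T : ℝ → Matrix (Fin n) (Fin n) ℝ} (hT : Continuous T)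
    {c : ℝ} {V : Submodule ℝ (Fin n → ℝ)} (hV : ((T c).toQuadraticForm'.restrict V).PosDef) :
    ∀ᶠ x in nhds c, ((T x).toQuadraticForm'.restrict V).PosDef := by
  have hK : IsCompact ((V : Set (Fin n → ℝ)) ∩ Metric.sphere 0 1) :=
    (isCompact_sphere 0 1).inter_left V.closed_of_finiteDimensional
  have hcont : Continuous fun z : ℝ × (Fin n → ℝ) => (T z.1).toQuadraticForm' z.2 := by
    simp only [Matrix.toQuadraticForm'_apply]
    fun_prop
  have hev : ∀ᶠ x in nhds c, ∀ v ∈ (V : Set (Fin n → ℝ)) ∩ Metric.sphere 0 1,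
      0 < (T x).toQuadraticForm' v := by
    refine hK.eventually_forall_of_forall_eventually fun v hv => ?_
    refine hcont.continuousAt.eventually (lt_mem_nhds ?_)
    refine hV ⟨v, hv.1⟩ fun h => ?_
    have h0 : v = 0 := congrArg Subtype.val h
    simpa [h0] using hv.2
  filter_upwards [hev] with x hx v hv
  have hv0 : (v : Fin n → ℝ) ≠ 0 := by simpa using hv
  have hnorm : 0 < ‖(v : Fin n → ℝ)‖ := norm_pos_iff.2 hv0
  have hpos := hx (‖(v : Fin n → ℝ)‖⁻¹ • (v : Fin n → ℝ))
    ⟨V.smul_mem _ v.2, by simp [norm_smul, hnorm.ne']⟩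
  rw [QuadraticMap.map_smul, smul_eq_mul] at hpos
  exact (pos_iff_pos_of_mul_pos hpos).1 (by positivity)

lemma Matrix.toQuadraticForm'_neg {n : ℕ} (M : Matrix (Fin n) (Fin n) ℝ) :
    (-M).toQuadraticForm' = -M.toQuadraticForm' := by
  ext v
  simp [Matrix.toQuadraticForm'_apply, Matrix.neg_mulVec]

lemma eventually_sigPos_le {n : ℕ} {T : ℝ → Matrix (Fin n) (Fin n) ℝ} (hT : Continuous T)
    (c : ℝ) :
    ∀ᶠ x in nhds c, sigPos (T c).toQuadraticForm' ≤ sigPos (T x).toQuadraticForm' := by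
  obtain ⟨V, hV, hpos⟩ := exists_finrank_eq_sigPos_and_posDef (T c).toQuadraticForm'
  filter_upwards [eventually_posDef_restrict hT hpos] with x hx
  exact hV ▸ le_sigPos_of_posDef _ hx

/-- The negative index of inertia is locally constant at nondegenerate forms. -/
lemma eventually_sigNeg_eq {n : ℕ} {T : ℝ → Matrix (Fin n) (Fin n) ℝ} (hT : Continuous T)
    {c : ℝ} (hrad : (T c).toQuadraticForm'.radical = ⊥) :
    ∀ᶠ x in nhds c, sigNeg (T x).toQuadraticForm' = sigNeg (T c).toQuadraticForm' := by
  have hneg : ∀ᶠ x in nhds c,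
      sigNeg (T c).toQuadraticForm' ≤ sigNeg (T x).toQuadraticForm' := by
    simpa [Matrix.toQuadraticForm'_neg] using eventually_sigPos_le hT.neg c
  filter_upwards [eventually_sigPos_le hT c, hneg] with x hpos hneg
  have hc := QuadraticForm.sigPos_add_sigNeg_add_radical (Q := (T c).toQuadraticForm')
  have hx := QuadraticForm.sigPos_add_sigNeg_add_radical (Q := (T x).toQuadraticForm')
  rw [hrad, finrank_bot] at hc
  omega

lemma Matrix.radical_toQuadraticForm'_eq_bot {n : ℕ} {M : Matrix (Fin n) (Fin n) ℝ}
    (hM : M.IsSymm) (hker : ∀ u, M *ᵥ u = 0 → u = 0) : M.toQuadraticForm'.radical = ⊥ := by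
  rw [Submodule.eq_bot_iff]
  intro u hu
  refine hker u (dotProduct_eq_zero _ fun v => ?_)
  obtain ⟨h0, h⟩ := QuadraticMap.mem_radical_iff'.1 hu
  have hv := h v
  have hsymm : u ⬝ᵥ M *ᵥ v = v ⬝ᵥ M *ᵥ u := by
    rw [dotProduct_mulVec, ← mulVec_transpose, hM.eq, dotProduct_comm]
  simp only [Matrix.toQuadraticForm'_apply, mulVec_add, dotProduct_add, add_dotProduct] at h0 hv
  rw [dotProduct_comm]
  linarith

/-- Splitting off the first coordinate along a vector `w` with `M *ᵥ w` supported there. -/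
lemma sigNeg_eq_add_sigNeg_submatrix {n : ℕ} {M : Matrix (Fin (n + 1)) (Fin (n + 1)) ℝ}
    (hM : M.IsSymm) {w : Fin (n + 1) → ℝ} {b : ℝ} (hw : w 0 ≠ 0)
    (hMw : M *ᵥ w = Pi.single 0 b) :
    sigNeg M.toQuadraticForm' = (if b * w 0 < 0 then 1 else 0) +
      sigNeg (M.submatrix Fin.succ Fin.succ).toQuadraticForm' := by
  have : Invertible (2 : ℝ) := invertibleOfNonzero two_ne_zero
  obtain ⟨a, ⟨e⟩⟩ :=
    (M.submatrix Fin.succ Fin.succ).toQuadraticForm'.equivalent_weightedSumSquares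
  let φ : (Fin (n + 1) → ℝ) ≃ₗ[ℝ] ℝ × (Fin (Module.finrank ℝ (Fin n → ℝ)) → ℝ) :=
    { toFun := fun v => (v 0 / w 0, e (fun i => v i.succ - v 0 / w 0 * w i.succ))
      invFun := fun z => z.1 • w + Fin.cons 0 (e.symm z.2)
      map_add' := fun u v => by
        refine Prod.ext (by simp [add_div]) ?_
        simp only [Prod.mk_add_mk, ← map_add]
        congr 1
        ext i
        simp
        ring
      map_smul' := fun t v => by
        refine Prod.ext (by simp [mul_div_assoc]) ?_
        simp only [Prod.smul_mk, RingHom.id_apply, ← map_smul]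
        congr 1
        ext i
        simp
        ring
      left_inv := fun v => by
        ext i
        cases i using Fin.cases <;> simp [hw]
      right_inv := fun z => by
        refine Prod.ext (by simp [hw]) ?_
        simp [hw] }
  let ψ := φ.trans (Fin.consLinearEquiv ℝ
    (fun _ : Fin (Module.finrank ℝ (Fin n → ℝ) + 1) => ℝ))
  have hψ (v : Fin (n + 1) → ℝ) :
      QuadraticMap.weightedSumSquares ℝ (Fin.cons (b * w 0) a :
        Fin (Module.finrank ℝ (Fin n → ℝ) + 1) → ℝ) (ψ v) = M.toQuadraticForm' v := by
    obtain ⟨z, rfl⟩ := φ.symm.surjective v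
    have hv : φ.symm z = z.1 • w + Fin.cons 0 (e.symm z.2) := rfl
    have hψz : ψ (φ.symm z) = Fin.cons z.1 z.2 := by
      simp only [ψ, LinearEquiv.trans_apply, LinearEquiv.apply_symm_apply]
      rfl
    have he : QuadraticMap.weightedSumSquares ℝ a z.2 =
        (M.submatrix Fin.succ Fin.succ).toQuadraticForm' (e.symm z.2) := by
      rw [← e.map_app, e.apply_symm_apply]
    have hcons (u : Fin n → ℝ) :
        (Fin.cons 0 u : Fin (n + 1) → ℝ) ⬝ᵥ M *ᵥ (Fin.cons 0 u : Fin (n + 1) → ℝ) =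
          u ⬝ᵥ M.submatrix Fin.succ Fin.succ *ᵥ u := by
      simp [dotProduct, mulVec, Fin.sum_univ_succ]
    have hcross (v : Fin (n + 1) → ℝ) : w ⬝ᵥ M *ᵥ v = b * v 0 := by
      rw [dotProduct_mulVec, ← mulVec_transpose, hM.eq, hMw, single_dotProduct]
    rw [hψz, hv, Matrix.toQuadraticForm'_apply, mulVec_add, mulVec_smul, add_dotProduct,
      dotProduct_add, dotProduct_add, hcons, hMw, ← Matrix.toQuadraticForm'_apply, ← he]
    simp [QuadraticMap.weightedSumSquares_apply, Fin.sum_univ_succ, hcross]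
    ring
  rw [QuadraticForm.sigNeg_of_equiv_weightedSumSquares ⟨⟨ψ, hψ⟩⟩,
    QuadraticForm.sigNeg_of_equiv_weightedSumSquares ⟨e⟩,
    Set.ncard_eq_toFinset_card', Set.ncard_eq_toFinset_card']
  simp only [Set.toFinset_ofPred, Fin.univ_succ, Finset.filter_cons, Finset.filter_map]
  split_ifs <;> simp_all [add_comm]

lemma sturmMatrix_isSymm (m : ℕ) (d : ℕ → ℝ[X]) (x : ℝ) : (sturmMatrix m d x).IsSymm := by
  ext i j
  simp only [sturmMatrix, transpose_apply, of_apply]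
  grind

lemma continuous_sturmMatrix (m : ℕ) (d : ℕ → ℝ[X]) : Continuous (sturmMatrix m d) := by
  refine continuous_matrix fun i j => ?_
  simp only [sturmMatrix, of_apply]
  split_ifs <;> fun_prop

lemma sturmMatrix_submatrix_succ (n : ℕ) (d : ℕ → ℝ[X]) (x : ℝ) :
    (sturmMatrix (n + 1) d x).submatrix Fin.succ Fin.succ =
      sturmMatrix n (fun i => d (i + 1)) x := by
  ext i j
  simp [sturmMatrix]

lemma sturmMatrix_mulVec_apply (m : ℕ) (d : ℕ → ℝ[X]) (x : ℝ) (z : ℕ → ℝ) (hz : z 0 = 0)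
    (hzm : z (m + 1) = 0) (i : Fin m) :
    (sturmMatrix m d x *ᵥ fun j => z (j + 1)) i =
      z i + (d (i + 1)).eval x * z (i + 1) + z (i + 2) := by
  have hentry (j : ℕ) : (if (i : ℕ) = j then (d (i + 1)).eval x
      else if (i : ℕ) + 1 = j ∨ j + 1 = i then 1 else 0) * z (j + 1) =
      (if j + 1 = i then z i else 0) + (if i = j then (d (i + 1)).eval x * z (i + 1) else 0) +
        (if i + 1 = j then z (i + 2) else 0) := by
    grind
  simp only [mulVec, dotProduct, sturmMatrix, of_apply]
  rw [Fin.sum_univ_eq_sum_range (fun j => (if (i : ℕ) = j then (d (i + 1)).eval x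
      else if (i : ℕ) + 1 = j ∨ j + 1 = i then 1 else 0) * z (j + 1)) m]
  simp only [hentry, Finset.sum_add_distrib]
  congr 1
  · congr 1
    · obtain ⟨i, hi⟩ := i
      cases i with
      | zero => simp [hz]
      | succ k => simp [Nat.lt_of_succ_lt hi]
    · simp
  · rw [Finset.sum_ite_eq]
    split_ifs with h
    · rfl
    · have : (i : ℕ) + 1 = m := by simp at h; omega
      rw [show (i : ℕ) + 2 = m + 1 by omega, hzm]

/-- The alternating chain vector is mapped to a multiple of the first basis vector. -/
lemma sturmMatrix_mulVec_alternating (n : ℕ) (d : ℕ → ℝ[X]) (x : ℝ) (p : ℕ → ℝ)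
    (hp : ∀ i ≤ n, p i = (d (i + 1)).eval x * p (i + 1) - p (i + 2)) (hlast : p (n + 2) = 0) :
    (sturmMatrix (n + 1) d x *ᵥ fun j => (-1) ^ (j : ℕ) * p (j + 1)) = Pi.single 0 (p 0) := by
  have hz := sturmMatrix_mulVec_apply (n + 1) d x
    (fun k => if k = 0 then 0 else (-1) ^ (k - 1) * p k) (by simp) (by simp [hlast])
  ext i
  refine (hz i).trans ?_
  obtain ⟨i, hi⟩ := i
  have h := hp i (by omega)
  cases i with
  | zero =>
    have : Pi.single (M := fun _ : Fin (n + 1) => ℝ) 0 (p 0) ⟨0, hi⟩ = p 0 := Pi.single_eq_same _ _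
    rw [this, h]; simp; ring
  | succ k =>
    rw [Pi.single_eq_of_ne (by simp [Fin.ext_iff])]
    simp [h, pow_succ]; ring

lemma sturmMatrix_ker_eq_bot (n : ℕ) (d : ℕ → ℝ[X]) (x : ℝ) (p : ℕ → ℝ)
    (hp : ∀ i < n, p i = (d (i + 1)).eval x * p (i + 1) - p (i + 2)) (hlast : p (n + 1) = 0)
    (h0 : p 0 ≠ 0) (u : Fin n → ℝ) (hu : sturmMatrix n d x *ᵥ u = 0) : u = 0 := by
  cases n with
  | zero => exact Subsingleton.elim _ _
  | succ n =>
    have hw := sturmMatrix_mulVec_alternating n d x p (fun i hi => hp i (by omega)) hlast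
    have hu0 : u 0 = 0 := by
      have h : u ⬝ᵥ Pi.single 0 (p 0) = 0 := by
        rw [← hw, dotProduct_mulVec, ← mulVec_transpose, (sturmMatrix_isSymm _ d x).eq, hu,
          zero_dotProduct]
      simpa [h0] using h
    let z : ℕ → ℝ := fun k => if h : 1 ≤ k ∧ k ≤ n + 1 then u ⟨k - 1, by omega⟩ else 0
    have hzu (j : Fin (n + 1)) : z (j + 1) = u j := by simp [z]; omega
    have hrow := sturmMatrix_mulVec_apply (n + 1) d x z (by simp [z]) (by simp [z])
    simp only [hzu, hu] at hrow
    have hz : ∀ k ≤ n, z k = 0 ∧ z (k + 1) = 0 := by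
      intro k hk
      induction k with
      | zero => exact ⟨by simp [z], by simpa [hu0] using hzu 0⟩
      | succ k ih =>
        obtain ⟨h1, h2⟩ := ih (by omega)
        have h := hrow ⟨k, by omega⟩
        rw [← hzu] at h
        simp only [h1, h2] at h
        exact ⟨h2, by simpa using h.symm⟩
    ext j
    rw [← hzu]
    exact (hz j (by omega)).2
lemma negInertia_sturmMatrix_succ (n : ℕ) (d : ℕ → ℝ[X]) (x : ℝ) (p : ℕ → ℝ)
    (hp : ∀ i ≤ n, p i = (d (i + 1)).eval x * p (i + 1) - p (i + 2)) (hlast : p (n + 2) = 0)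
    (h1 : p 1 ≠ 0) :
    negInertia (sturmMatrix (n + 1) d x) = (if p 0 * p 1 < 0 then 1 else 0) +
      sigNeg (sturmMatrix n (fun i => d (i + 1)) x).toQuadraticForm' := by
  have hsymm := sturmMatrix_isSymm (n + 1) d x
  rw [negInertia_eq_sigNeg (by simpa [IsHermitian, IsSymm] using hsymm),
    sigNeg_eq_add_sigNeg_submatrix hsymm (by simpa using h1)
      (sturmMatrix_mulVec_alternating n d x p hp hlast), sturmMatrix_submatrix_succ]
  simp

lemma Polynomial.eventually_eval_ne_zero {p : ℝ[X]} (hp : p ≠ 0) (c : ℝ) :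
    ∀ᶠ x in nhdsWithin c {c}ᶜ, p.eval x ≠ 0 := by
  have hfin : {x | p.IsRoot x}.Finite := Polynomial.finite_setOfPred_isRoot hp
  have hmem : ({x | p.IsRoot x} \ {c})ᶜ ∈ nhds c :=
    (hfin.subset Set.sdiff_subset).isClosed.isOpen_compl.mem_nhds (by simp)
  filter_upwards [mem_nhdsWithin_of_mem_nhds hmem, self_mem_nhdsWithin] with x hx hxc h0
  exact hx ⟨h0, hxc⟩

theorem stmt15 (f g : Polynomial ℝ)
    (hf : 0 < f.natDegree) (hg : 0 < g.natDegree)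
    (m : ℕ) (hm : 1 ≤ m)
    (F d : ℕ → Polynomial ℝ)
    (hF0 : F 0 = f) (hF1 : F 1 = g)
    (hrec : ∀ i, 1 ≤ i → i < m → F (i - 1) = d i * F i - F (i + 1))
    (hdeg : ∀ i, 1 ≤ i → i < m → (F (i + 1)).degree < (F i).degree)
    (hlast : F (m - 1) = d m * F m)
    (hFm : F m ≠ 0)
    (c : ℝ) (hc : (f / F m).eval c = 0) :
    ∃ ε > (0 : ℝ),
      (∀ x ∈ Set.Ioo (c - ε) (c + ε), x ≠ c → f.eval x ≠ 0 ∧ g.eval x ≠ 0) ∧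
      (∀ x ∈ Set.Ioo (c - ε) (c + ε), x ≠ c →
        (f.eval x * g.eval x > 0 →
          negInertia (sturmMatrix m d x) = negInertia (sturmMatrix m d c)) ∧
        (f.eval x * g.eval x < 0 →
          negInertia (sturmMatrix m d x) = negInertia (sturmMatrix m d c) + 1)) := by
  obtain ⟨n, rfl⟩ : ∃ n, m = n + 1 := ⟨m - 1, by omega⟩
  have hF (i : ℕ) (hi : i < n) : F i = d (i + 1) * F (i + 1) - F (i + 2) := by
    simpa using hrec (i + 1) (by omega) (by omega)
  have hdvd : ∀ k ≤ n, F (n + 1) ∣ F (n + 1 - k) ∧ F (n + 1) ∣ F (n - k) := by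
    intro k hk
    induction k with
    | zero => exact ⟨dvd_rfl, Dvd.intro_left _ (by simpa using hlast.symm)⟩
    | succ k ih =>
      obtain ⟨h1, h2⟩ := ih (by omega)
      refine ⟨by convert h2 using 2; omega, ?_⟩
      have h := hF (n - (k + 1)) (by omega)
      rw [show n - (k + 1) + 1 = n - k by omega, show n - (k + 1) + 2 = n + 1 - k by omega] at h
      exact h ▸ dvd_sub (h2.mul_left _) h1
  let G : ℕ → ℝ[X] := fun i => if i ≤ n + 1 then F i / F (n + 1) else 0
  have hFG (i : ℕ) (hi : i ≤ n + 1) : F i = F (n + 1) * G i := by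
    have h : F (n + 1) ∣ F i := by
      rcases hi.eq_or_lt with rfl | hi
      · rfl
      · simpa [show n - (n - i) = i by omega] using (hdvd (n - i) (by omega)).2
    simp only [G, if_pos hi]
    exact (EuclideanDomain.mul_div_cancel' hFm h).symm
  have hGlast : G (n + 2) = 0 := by simp [G]
  have hGone : G (n + 1) = 1 := by simp [G, hFm]
  have hG (i : ℕ) (hi : i ≤ n) : G i = d (i + 1) * G (i + 1) - G (i + 2) := by
    apply mul_left_cancel₀ hFm
    rw [← hFG i (by omega)]
    rcases hi.eq_or_lt with rfl | hi
    · rw [hGlast, hGone]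
      simpa [mul_comm] using hlast
    · rw [hF i hi, hFG (i + 1) (by omega), hFG (i + 2) (by omega)]
      ring
  have hGeval (x : ℝ) (i : ℕ) (hi : i ≤ n) :
      (G i).eval x = (d (i + 1)).eval x * (G (i + 1)).eval x - (G (i + 2)).eval x := by
    simpa using congrArg (Polynomial.eval x) (hG i hi)
  have hG0 : (G 0).eval c = 0 := by simpa [G, hF0] using hc
  have hG1 : (G 1).eval c ≠ 0 := by
    intro h1
    have hall : ∀ i ≤ n, (G i).eval c = 0 ∧ (G (i + 1)).eval c = 0 := by
      intro i hi
      induction i with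
      | zero => exact ⟨hG0, h1⟩
      | succ i ih =>
        obtain ⟨h, h'⟩ := ih (by omega)
        have := hGeval c i (by omega)
        rw [h, h'] at this
        exact ⟨h', by linarith⟩
    simpa [hGone] using (hall n le_rfl).2
  have hformula (x : ℝ) (hx : (G 1).eval x ≠ 0) :=
    negInertia_sturmMatrix_succ n d x (fun i => (G i).eval x) (hGeval x) (by simp [hGlast]) hx
  have hrad := Matrix.radical_toQuadraticForm'_eq_bot
    (sturmMatrix_isSymm n (fun i => d (i + 1)) c)
    (sturmMatrix_ker_eq_bot n (fun i => d (i + 1)) c (fun i => (G (i + 1)).eval c)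
      (fun i hi => hGeval c (i + 1) hi) (by simp [hGlast]) hG1)
  have hsig := eventually_sigNeg_eq (continuous_sturmMatrix n fun i => d (i + 1)) hrad
  have hG1ev : ∀ᶠ x in nhds c, (G 1).eval x ≠ 0 := (G 1).continuous.continuousAt.eventually_ne hG1
  have hfev := Polynomial.eventually_eval_ne_zero (ne_zero_of_natDegree_gt hf) c
  have hgev := Polynomial.eventually_eval_ne_zero (ne_zero_of_natDegree_gt hg) c
  rw [eventually_nhdsWithin_iff] at hfev hgev
  obtain ⟨ε, hε, hball⟩ := Metric.eventually_nhds_iff_ball.1 (hsig.and (hG1ev.and (hfev.and hgev)))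
  rw [Real.ball_eq_Ioo] at hball
  refine ⟨ε, hε, fun x hx hxc => ⟨(hball x hx).2.2.1 hxc, (hball x hx).2.2.2 hxc⟩,
    fun x hx hxc => ?_⟩
  obtain ⟨hs, h1, hfx, -⟩ := hball x hx
  have hfg : f.eval x * g.eval x = (F (n + 1)).eval x ^ 2 * ((G 0).eval x * (G 1).eval x) := by
    rw [← hF0, ← hF1, hFG 0 (by omega), hFG 1 (by omega), eval_mul, eval_mul]
    ring
  rw [hfg, hformula x h1, hformula c hG1, hs]
  simp only [hG0, zero_mul, lt_irrefl, if_false, zero_add]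
  constructor
  · intro h
    rw [if_neg (pos_of_mul_pos_right h (sq_nonneg _)).le.not_gt, zero_add]
  · intro h
    rw [if_pos (neg_of_mul_neg_right h (sq_nonneg _)), add_comm]
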